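/- Let G be a finite group, H ≤ G. The Res-Ind chain is reversible with respect to the Plancherel measure of G: with M_Pl(ξ) = (dim ξ)²/|G|, one has M_Pl(ξ) P_{ξμ} = M_Pl(μ) P_{μξ} for all ξ, μ ∈ Irr(G). -/

import Mathlib

open CategoryTheory
open scoped Classical

/-- Inner product of class functions on a finite group/monoid carrier:
⟨f,g⟩ = |X|⁻¹ Σ_x f(x) conj(g(x)). -/
noncomputable def classInner (X : Type) (f g : X → ℂ) : ℂ :=
  (Nat.card X : ℂ)⁻¹ * ∑ᶠ x : X, f x * (starRingEnd ℂ) (g x)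

/-- The character of the induced representation Ind_H^G of a class function f on H:
(Ind f)(g) = |H|⁻¹ Σ_{x ∈ G, x⁻¹gx ∈ H} f(x⁻¹gx). -/
noncomputable def indChar {G : Type} [Group G] (H : Subgroup G) (f : H → ℂ) : G → ℂ :=
  fun g => (Nat.card H : ℂ)⁻¹ *
    ∑ᶠ x : G, if hx : x⁻¹ * g * x ∈ H then f ⟨x⁻¹ * g * x, hx⟩ else 0

/-- P↓_{ξη} = ⟨Res_H ξ, η⟩ dim η / dim ξ. -/
noncomputable def Pdown {G : Type} [Group G] (H : Subgroup G)
    (ξ : FDRep ℂ G) (η : FDRep ℂ H) : ℂ :=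
  classInner H (fun h => ξ.character h) η.character *
    (Module.finrank ℂ η) / (Module.finrank ℂ ξ)

/-- P↑_{ημ} = ⟨Ind_H^G η, μ⟩ dim μ / ([G:H] dim η). -/
noncomputable def Pup {G : Type} [Group G] (H : Subgroup G)
    (η : FDRep ℂ H) (μ : FDRep ℂ G) : ℂ :=
  classInner G (indChar H η.character) μ.character *
    (Module.finrank ℂ μ) / ((H.index : ℂ) * (Module.finrank ℂ η))

/-- The Res-Ind matrix P = P↓P↑ on (a complete family indexing) Irr(G). -/
noncomputable def resIndP {G : Type} [Group G] (H : Subgroup G)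
    {ιG ιH : Type} [Fintype ιH] (ρ : ιG → FDRep ℂ G) (σ : ιH → FDRep ℂ H)
    (ξ μ : ιG) : ℂ :=
  ∑ η : ιH, Pdown H (ρ ξ) (σ η) * Pup H (σ η) (ρ μ)

open scoped ComplexOrder in
theorem aux_matrix_trace_inv {K : Type} [Group K] [Fintype K] {n : Type} [Fintype n] [DecidableEq n]
    (M : K →* Matrix n n ℂ) (h : K) :
    (M h⁻¹).trace = (starRingEnd ℂ) (M h).trace := by
  set S : Matrix n n ℂ := ∑ g : K, (M g).conjTranspose * M g with hS
  have hpos : S.PosDef := by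
    rw [hS, ← Finset.add_sum_erase _ _ (Finset.mem_univ (1 : K))]
    refine Matrix.PosDef.add_posSemidef ?_ ?_
    · simpa using Matrix.PosDef.one
    · exact Matrix.posSemidef_sum _ (fun g _ => Matrix.posSemidef_conjTranspose_mul_self _)
  have hu : IsUnit S.det := (Matrix.isUnit_iff_isUnit_det S).1 hpos.isUnit
  have hinv : (M h).conjTranspose * S * M h = S := by
    rw [hS, Finset.mul_sum, Finset.sum_mul]
    refine Fintype.sum_equiv (Equiv.mulRight h) _ _ (fun g => ?_)
    simp [Matrix.conjTranspose_mul, mul_assoc]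
  have h1 : M h * M h⁻¹ = 1 := by rw [← map_mul]; simp
  have h2 : (M h).conjTranspose * S = S * M h⁻¹ := by
    calc (M h).conjTranspose * S = (M h).conjTranspose * S * (M h * M h⁻¹) := by rw [h1, mul_one]
      _ = S * M h⁻¹ := by rw [← mul_assoc, hinv]
  have h3 : M h⁻¹ = S⁻¹ * ((M h).conjTranspose * S) := by
    rw [h2, ← mul_assoc, Matrix.nonsing_inv_mul _ hu, one_mul]
  rw [h3, Matrix.trace_mul_comm, mul_assoc, Matrix.mul_nonsing_inv _ hu, mul_one,
    Matrix.trace_conjTranspose]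
  rfl

theorem aux_char_inv {K : Type} [Group K] [Fintype K] (V : FDRep ℂ K) (h : K) :
    V.character h⁻¹ = (starRingEnd ℂ) (V.character h) := by
  let b := Module.finBasis ℂ V
  let M : K →* Matrix (Fin (Module.finrank ℂ V)) (Fin (Module.finrank ℂ V)) ℂ :=
    (LinearMap.toMatrixAlgEquiv b).toAlgHom.toRingHom.toMonoidHom.comp V.ρ
  have key : ∀ g, V.character g = (M g).trace := fun g =>
    LinearMap.trace_eq_matrix_trace ℂ b (V.ρ g)
  rw [key, key, aux_matrix_trace_inv]

theorem aux_frobenius {G : Type} [Group G] [Fintype G] (H : Subgroup G)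
    (f : H → ℂ) (V : FDRep ℂ G) :
    classInner G (indChar H f) V.character = classInner H f (fun h => V.character h) := by
  unfold classInner indChar
  simp only [finsum_eq_sum_of_fintype]
  have hG : (Nat.card G : ℂ) ≠ 0 := by exact_mod_cast Nat.card_pos.ne'
  have key : ∀ x : G, ∑ g : G, (if hx : x⁻¹ * g * x ∈ H then f ⟨x⁻¹ * g * x, hx⟩ else 0) *
      (starRingEnd ℂ) (V.character g) = ∑ h : H, f h * (starRingEnd ℂ) (V.character h) := by
    intro x
    have e1 : ∑ h : H, f h * (starRingEnd ℂ) (V.character h) =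
        ∑ k : G, (if hk : k ∈ H then f ⟨k, hk⟩ else 0) * (starRingEnd ℂ) (V.character k) := by
      rw [← Finset.sum_subset (Finset.subset_univ (Finset.univ.filter (· ∈ H)))
        (by intro k _ hk; simp at hk; simp [hk]),
        Finset.sum_subtype (p := (· ∈ H)) _ (by simp)]
      exact Finset.sum_congr rfl (fun h _ => by simp)
    rw [e1]
    refine Fintype.sum_equiv (MulAut.conj x⁻¹).toEquiv _ _ (fun g => ?_)
    have := V.char_conj g x⁻¹
    simp only [inv_inv] at this
    simp [this]
  have : ∑ g : G, ((Nat.card H : ℂ)⁻¹ *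
      ∑ x : G, if hx : x⁻¹ * g * x ∈ H then f ⟨x⁻¹ * g * x, hx⟩ else 0) *
      (starRingEnd ℂ) (V.character g) =
      (Nat.card H : ℂ)⁻¹ * (Nat.card G *
        ∑ h : H, f h * (starRingEnd ℂ) (V.character h)) := by
    simp_rw [mul_assoc (Nat.card H : ℂ)⁻¹, ← Finset.mul_sum, Finset.sum_mul]
    rw [Finset.sum_comm, Finset.sum_congr rfl (fun x _ => key x)]
    simp [Nat.card_eq_fintype_card]
  rw [this]
  field_simp

theorem aux_inner_comm {G : Type} [Group G] [Fintype G] (H : Subgroup G)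
    (W : FDRep ℂ H) (V : FDRep ℂ G) :
    classInner H W.character (fun h => V.character h) =
      classInner H (fun h => V.character h) W.character := by
  unfold classInner
  simp only [finsum_eq_sum_of_fintype]
  congr 1
  refine Fintype.sum_equiv (Equiv.inv H) _ _ (fun h => ?_)
  simp [aux_char_inv, mul_comm]

/-- the Res-Ind chain is reversible with respect to the Plancherel measure
M_Pl(ξ) = (dim ξ)²/|G| : M_Pl(ξ) P_{ξμ} = M_Pl(μ) P_{μξ} for all ξ, μ ∈ Irr(G). -/
theorem resIndP_reversible_plancherel
    (G : Type) [Group G] [Fintype G] (H : Subgroup G)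
    (ιG ιH : Type) [Fintype ιG] [Fintype ιH]
    (ρ : ιG → FDRep ℂ G) (σ : ιH → FDRep ℂ H)
    (hρs : ∀ i, Simple (ρ i)) (hρd : ∀ i j, Nonempty (ρ i ≅ ρ j) → i = j)
    (hρc : ∀ V : FDRep ℂ G, Simple V → ∃ i, Nonempty (V ≅ ρ i))
    (hσs : ∀ i, Simple (σ i)) (hσd : ∀ i j, Nonempty (σ i ≅ σ j) → i = j)
    (hσc : ∀ V : FDRep ℂ H, Simple V → ∃ i, Nonempty (V ≅ σ i)) :
    ∀ ξ μ, ((Module.finrank ℂ (ρ ξ) : ℂ) ^ 2 / (Fintype.card G : ℂ)) * resIndP H ρ σ ξ μ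
      = ((Module.finrank ℂ (ρ μ) : ℂ) ^ 2 / (Fintype.card G : ℂ)) * resIndP H ρ σ μ ξ := by
  intro ξ μ
  unfold resIndP
  rw [Finset.mul_sum, Finset.mul_sum]
  refine Finset.sum_congr rfl (fun η _ => ?_)
  unfold Pdown Pup
  rw [aux_frobenius, aux_frobenius, aux_inner_comm, aux_inner_comm]
  by_cases h1 : (Module.finrank ℂ (ρ ξ) : ℂ) = 0
  · simp [h1]
  by_cases h2 : (Module.finrank ℂ (ρ μ) : ℂ) = 0
  · simp [h2]
  field_simp
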